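/- Let ż ∈ ℂ and let V be a simple R_ż-module that is torsion-free over ℂ[t], i.e. no nonzero element of V is annihilated by a nonzero polynomial in t. Then t acts bijectively on V. -/

import Mathlib

set_option synthInstance.maxHeartbeats 1000000
set_option maxHeartbeats 2000000


open scoped TensorProduct

noncomputable section

/-- The ageing Lie algebra `𝔞`: a complex Lie algebra with basis `{E, H, P, Q, Z}` and
nonzero brackets `[H,E] = 2E`, `[H,P] = P`, `[H,Q] = -Q`, `[E,Q] = P`, `[P,Q] = Z`,
with `Z` central and all other brackets of basis elements zero. -/
structure IsAgeingBasis (𝔞 : Type*) [LieRing 𝔞] [LieAlgebra ℂ 𝔞]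
    (E H P Q Z : 𝔞) : Prop where
  indep : LinearIndependent ℂ ![E, H, P, Q, Z]
  span : Submodule.span ℂ {E, H, P, Q, Z} = ⊤
  lie_he : ⁅H, E⁆ = (2 : ℂ) • E
  lie_hp : ⁅H, P⁆ = P
  lie_hq : ⁅H, Q⁆ = -Q
  lie_eq : ⁅E, Q⁆ = P
  lie_pq : ⁅P, Q⁆ = Z
  lie_ep : ⁅E, P⁆ = 0
  lie_ez : ⁅E, Z⁆ = 0
  lie_hz : ⁅H, Z⁆ = 0
  lie_pz : ⁅P, Z⁆ = 0
  lie_qz : ⁅Q, Z⁆ = 0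

/-- The operator `d/dt` on `ℂ[t]`. -/
def Dt : Module.End ℂ (Polynomial ℂ) := Polynomial.derivative

/-- The operator of multiplication by `t` on `ℂ[t]`. -/
def Tm : Module.End ℂ (Polynomial ℂ) := LinearMap.mulLeft ℂ Polynomial.X

/-- The first Weyl algebra, realized as the subalgebra of endomorphisms of `ℂ[t]`
generated by `d/dt` and multiplication by `t`. -/
def WeylA : Subalgebra ℂ (Module.End ℂ (Polynomial ℂ)) := Algebra.adjoin ℂ {Dt, Tm}

/-- `R₀`: the subalgebra of the Weyl algebra generated by `t` and `t²(d/dt)`. -/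
def R0 : Subalgebra ℂ (Module.End ℂ (Polynomial ℂ)) := Algebra.adjoin ℂ {Tm, Tm ^ 2 * Dt}

/-- `R₁`: the subalgebra of the Weyl algebra generated by `t` and `t(d/dt)`. -/
def R1 : Subalgebra ℂ (Module.End ℂ (Polynomial ℂ)) := Algebra.adjoin ℂ {Tm, Tm * Dt}

/-- `R_zc`, which is `R₀` for `zc = 0` and `R₁` otherwise. -/
def Rz (zc : ℂ) : Subalgebra ℂ (Module.End ℂ (Polynomial ℂ)) := if zc = 0 then R0 else R1

/-- The element `t` of `R_zc`. -/
def tR (zc : ℂ) : Rz zc :=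
  ⟨Tm, by unfold Rz; split <;> exact Algebra.subset_adjoin (by simp)⟩

/-- The second canonical generator of `R_zc`: `t²(d/dt)` if `zc = 0` and `t(d/dt)` otherwise. -/
def dR (zc : ℂ) : Rz zc :=
  ⟨if zc = 0 then Tm ^ 2 * Dt else Tm * Dt, by
    unfold Rz; split_ifs <;> exact Algebra.subset_adjoin (by simp)⟩


/-- The element `t` of `R₀`. -/
def tR0 : R0 := ⟨Tm, Algebra.subset_adjoin (by simp)⟩

/-- The element `t²(d/dt)` of `R₀`. -/
def dR0 : R0 := ⟨Tm ^ 2 * Dt, Algebra.subset_adjoin (by simp)⟩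

/-- The element `t` of `R₁`. -/
def tR1 : R1 := ⟨Tm, Algebra.subset_adjoin (by simp)⟩

/-- The element `t(d/dt)` of `R₁`. -/
def dR1 : R1 := ⟨Tm * Dt, Algebra.subset_adjoin (by simp)⟩

/-- Right multiplication by `t` can be moved to the left in a subalgebra generated by `t` and an
operator `D` for which this is possible. -/
theorem exists_mul_Tm_eq_Tm_mul {D : Module.End ℂ (Polynomial ℂ)}
    (hD : ∃ D' ∈ Algebra.adjoin ℂ {Tm, D}, D * Tm = Tm * D')
    {r : Module.End ℂ (Polynomial ℂ)} (hr : r ∈ Algebra.adjoin ℂ {Tm, D}) :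
    ∃ r' ∈ Algebra.adjoin ℂ {Tm, D}, r * Tm = Tm * r' := by
  induction hr using Algebra.adjoin_induction with
  | mem x hx =>
    rcases hx with rfl | rfl
    · exact ⟨Tm, Algebra.subset_adjoin (by simp), rfl⟩
    · exact hD
  | algebraMap c => exact ⟨algebraMap ℂ _ c, Subalgebra.algebraMap_mem _ c, Algebra.commutes c Tm⟩
  | add x y _ _ hx hy =>
    obtain ⟨x', hx', ex⟩ := hx
    obtain ⟨y', hy', ey⟩ := hy
    exact ⟨x' + y', add_mem hx' hy', by rw [add_mul, mul_add, ex, ey]⟩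
  | mul x y _ _ hx hy =>
    obtain ⟨x', hx', ex⟩ := hx
    obtain ⟨y', hy', ey⟩ := hy
    exact ⟨x' * y', mul_mem hx' hy', by rw [mul_assoc, ey, ← mul_assoc, ex, mul_assoc]⟩

/-- The canonical commutation relation `∂ t = t ∂ + 1` in the Weyl algebra. -/
theorem Dt_mul_Tm : Dt * Tm = Tm * Dt + 1 := by
  refine LinearMap.ext fun p => ?_
  simp [Dt, Tm, Polynomial.derivative_mul, add_comm]

/-- Every product `r t` in `R_zc` is of the form `t s`. -/
theorem exists_mul_tR_eq_tR_mul (zc : ℂ) (r : Rz zc) : ∃ r' : Rz zc, r * tR zc = tR zc * r' := by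
  suffices h : ∃ r' ∈ Rz zc, (r : Module.End ℂ (Polynomial ℂ)) * Tm = Tm * r' by
    obtain ⟨r', hr', e⟩ := h
    exact ⟨⟨r', hr'⟩, Subtype.ext e⟩
  obtain ⟨r, hr⟩ := r
  have hT (D : Module.End ℂ (Polynomial ℂ)) : Tm ∈ Algebra.adjoin ℂ {Tm, D} :=
    Algebra.subset_adjoin (by simp)
  have hD (D : Module.End ℂ (Polynomial ℂ)) : D ∈ Algebra.adjoin ℂ {Tm, D} :=
    Algebra.subset_adjoin (by simp)
  unfold Rz at hr ⊢
  split_ifs at hr ⊢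
  · refine exists_mul_Tm_eq_Tm_mul ⟨Tm ^ 2 * Dt + Tm, add_mem (hD _) (hT _), ?_⟩ hr
    rw [mul_assoc, Dt_mul_Tm]
    noncomm_ring
  · refine exists_mul_Tm_eq_Tm_mul ⟨Tm * Dt + 1, add_mem (hD _) (one_mem _), ?_⟩ hr
    rw [mul_assoc, Dt_mul_Tm]

/-- Let `zc ∈ ℂ` and let `V` be a simple `R_zc`-module that is
torsion-free over `ℂ[t]`, i.e. no nonzero element of `V` is annihilated by a nonzero
polynomial in `t`.  Then `t` acts bijectively on `V`. -/
theorem t_bijective_of_torsionFree (zc : ℂ)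
    (V : Type*) [AddCommGroup V] [Module (Rz zc) V]
    (hsimple : IsSimpleModule (Rz zc) V)
    (htf : ∀ (v : V) (f : Polynomial ℂ), f ≠ 0 →
      Polynomial.aeval (tR zc) f • v = 0 → v = 0) :
    Function.Bijective (fun v : V => tR zc • v) := by
  have inj : ∀ v : V, tR zc • v = 0 → v = 0 := fun v hv =>
    htf v Polynomial.X Polynomial.X_ne_zero (by rwa [Polynomial.aeval_X])
  let N : Submodule (Rz zc) V :=
    { carrier := Set.range fun v : V => tR zc • v
      add_mem' := by
        rintro _ _ ⟨v, rfl⟩ ⟨w, rfl⟩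
        exact ⟨v + w, smul_add _ v w⟩
      zero_mem' := ⟨0, smul_zero _⟩
      smul_mem' := by
        rintro r _ ⟨v, rfl⟩
        obtain ⟨r', e⟩ := exists_mul_tR_eq_tR_mul zc r
        exact ⟨r' • v, by simp only [smul_smul, e]⟩ }
  refine ⟨fun v w h => sub_eq_zero.mp (inj _ ?_), ?_⟩
  · rw [smul_sub, sub_eq_zero]
    exact h
  have : Nontrivial V := IsSimpleModule.nontrivial (Rz zc) V
  obtain ⟨v, hv⟩ := exists_ne (0 : V)
  have : IsSimpleOrder (Submodule (Rz zc) V) := (isSimpleModule_iff (Rz zc) V).mp hsimple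
  rcases eq_bot_or_eq_top N with hN | hN
  · have hm : tR zc • v ∈ N := ⟨v, rfl⟩
    rw [hN, Submodule.mem_bot] at hm
    exact absurd (inj v hm) hv
  · intro w
    have hw : w ∈ N := hN ▸ Submodule.mem_top
    exact hw

end
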